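/- Let a, b, N be real numbers with a, a+b+1, a+b+N+1 ∉ {−1,−2,−3,…}, and let n ≥ 0 be an integer such that 2n+a+b−1, 2n+a+b, 2n+a+b+1 and 2n+a+b+2 are all nonzero. Then the Hahn polynomials satisfy the three-term recurrence x h_n^{a,b,N}(x) = a_{n+1} h_{n+1}^{a,b,N}(x) + b_n h_n^{a,b,N}(x) + c_n h_{n−1}^{a,b,N}(x) (with h_{−1}^{a,b,N} = 0), where a_n = −n(n+a)(n+a+b+N+1)/[(2n+a+b−1)(2n+a+b)], b_n = [N(a+1)(a+b) + n(2N+b−a)(n+a+b+1)]/[(2n+a+b)(2n+a+b+2)], and c_n = −(n+a+b)(n+b)(N−n+1)/[(2n+a+b)(2n+a+b+1)]. -/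

import Mathlib

open Polynomial Finset

/-- Pochhammer symbol `(z)_k = z(z+1)⋯(z+k−1)` for real `z`. -/
noncomputable def pch (k : ℕ) (z : ℝ) : ℝ := (ascPochhammer ℝ k).eval z

/-- The Hahn polynomial. -/
noncomputable def hahn (a b N : ℝ) (n : ℕ) : Polynomial ℝ :=
  ∑ j ∈ Finset.range (n + 1),
    Polynomial.C (pch (n - j) (N - (n : ℝ) + 1) * pch (j + n) (a + b + 1) /
      (pch n (2 + a + b + N) * pch j (a + 1) *
        (Nat.factorial (n - j) : ℝ) * (Nat.factorial j : ℝ))) *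
      ((ascPochhammer ℝ j).comp (-Polynomial.X))

/-- The coefficient of `(−x)_j` in the `n`-th Hahn polynomial, extended by zero to `j > n`. -/
noncomputable def hahnCoeff (a b N : ℝ) (n j : ℕ) : ℝ :=
  if j ≤ n then
    pch (n - j) (N - (n : ℝ) + 1) * pch (j + n) (a + b + 1) /
      (pch n (2 + a + b + N) * pch j (a + 1) *
        (Nat.factorial (n - j) : ℝ) * (Nat.factorial j : ℝ))
  else 0

lemma hahnCoeff_of_lt (a b N : ℝ) {n j : ℕ} (h : n < j) : hahnCoeff a b N n j = 0 :=
  if_neg h.not_ge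

lemma hahnCoeff_add (a b N : ℝ) (j m : ℕ) :
    hahnCoeff a b N (j + m) j = pch m (N - ((j : ℝ) + m) + 1) * pch (j + (j + m)) (a + b + 1) /
      (pch (j + m) (2 + a + b + N) * pch j (a + 1) *
        (Nat.factorial m : ℝ) * (Nat.factorial j : ℝ)) := by
  simp [hahnCoeff]

lemma hahn_eq_sum (a b N : ℝ) {n M : ℕ} (h : n < M) :
    hahn a b N n =
      ∑ j ∈ Finset.range M, C (hahnCoeff a b N n j) * (ascPochhammer ℝ j).comp (-X) := by
  have hsub : Finset.range (n + 1) ⊆ Finset.range M := by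
    intro i hi
    simp only [Finset.mem_range] at hi ⊢
    omega
  rw [hahn, ← Finset.sum_subset hsub]
  · refine Finset.sum_congr rfl fun j hj => ?_
    rw [hahnCoeff, if_pos (Nat.lt_succ_iff.mp (Finset.mem_range.mp hj))]
  · intro j _ hj
    rw [hahnCoeff_of_lt a b N (by simpa using hj)]
    simp

lemma X_mul_ascPochhammer_comp_neg (j : ℕ) :
    X * (ascPochhammer ℝ j).comp (-X) =
      C (j : ℝ) * (ascPochhammer ℝ j).comp (-X) - (ascPochhammer ℝ (j + 1)).comp (-X) := by
  rw [ascPochhammer_succ_right]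
  simp
  ring

lemma X_mul_hahn (a b N : ℝ) (n : ℕ) :
    X * hahn a b N n = ∑ j ∈ Finset.range (n + 2),
      C ((j : ℝ) * hahnCoeff a b N n j - (if j = 0 then 0 else hahnCoeff a b N n (j - 1))) *
        (ascPochhammer ℝ j).comp (-X) := by
  have hshift : ∑ j ∈ Finset.range (n + 2),
      C (if j = 0 then 0 else hahnCoeff a b N n (j - 1)) * (ascPochhammer ℝ j).comp (-X) =
      ∑ j ∈ Finset.range (n + 1),
        C (hahnCoeff a b N n j) * (ascPochhammer ℝ (j + 1)).comp (-X) := by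
    rw [Finset.sum_range_succ']
    simp
  simp only [C_sub, sub_mul, Finset.sum_sub_distrib]
  rw [hshift, Finset.sum_range_succ, hahnCoeff_of_lt a b N (Nat.lt_succ_self n),
    hahn_eq_sum a b N (Nat.lt_succ_self n), Finset.mul_sum]
  simp only [mul_zero, C_0, zero_mul, add_zero]
  rw [← Finset.sum_sub_distrib]
  refine Finset.sum_congr rfl fun j _ => ?_
  rw [mul_left_comm, X_mul_ascPochhammer_comp_neg, C_mul]
  ring

lemma pch_zero (z : ℝ) : pch 0 z = 1 := by simp [pch]

lemma pch_succ (k : ℕ) (z : ℝ) : pch (k + 1) z = pch k z * (z + k) := by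
  simp [pch, ascPochhammer_succ_right]

lemma pch_succ_left (k : ℕ) (z : ℝ) : pch (k + 1) z = z * pch k (z + 1) := by
  simp [pch, ascPochhammer_succ_left]

lemma pch_ne_zero (k : ℕ) {z : ℝ} (hz : ∀ i : ℕ, z + i ≠ 0) : pch k z ≠ 0 := by
  induction k with
  | zero => simp [pch_zero]
  | succ k ih => rw [pch_succ]; exact mul_ne_zero ih (hz k)

/-- The coefficientwise form of the three-term recurrence. -/
lemma hahnCoeff_recurrence (a b N : ℝ)
    (ha : ∀ k : ℕ, a + 1 + k ≠ 0) (habN : ∀ k : ℕ, 2 + a + b + N + k ≠ 0) (n j : ℕ)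
    (hj : j ≤ n + 1)
    {s : ℝ} (hs : s = 2 * (n : ℝ) + a + b) (h0 : s ≠ 0) (h1 : s + 1 ≠ 0) (h2 : s + 2 ≠ 0) :
    (j : ℝ) * hahnCoeff a b N n j - (if j = 0 then 0 else hahnCoeff a b N n (j - 1)) =
      -((((n : ℝ) + 1) * (((n : ℝ) + 1) + a) * (((n : ℝ) + 1) + a + b + N + 1)) /
            ((s + 1) * (s + 2))) *
          hahnCoeff a b N (n + 1) j
        + (N * (a + 1) * (a + b) + (n : ℝ) * (2 * N + b - a) * ((n : ℝ) + a + b + 1)) /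
            (s * (s + 2)) *
          hahnCoeff a b N n j
        + -((((n : ℝ) + a + b) * ((n : ℝ) + b) * (N - (n : ℝ) + 1)) /
            (s * (s + 1))) *
          (if n = 0 then 0 else hahnCoeff a b N (n - 1) j) := by
  have hf : ∀ k : ℕ, (Nat.factorial k : ℝ) ≠ 0 := fun k => by positivity
  have hsucc : ∀ k : ℕ, (k : ℝ) + 1 ≠ 0 := fun k => by positivity
  have hsucc2 : ∀ k : ℕ, (k : ℝ) + 1 + 1 ≠ 0 := fun k => by positivity
  have hD : ∀ k : ℕ, pch k (2 + a + b + N) ≠ 0 := fun k => pch_ne_zero k habN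
  have hQ : ∀ k : ℕ, pch k (a + 1) ≠ 0 := fun k => pch_ne_zero k ha
  obtain rfl | hlt := eq_or_lt_of_le hj
  · have hc : hahnCoeff a b N n (n + 1) = 0 := hahnCoeff_of_lt a b N (Nat.lt_succ_self n)
    have hp : (if n = 0 then 0 else hahnCoeff a b N (n - 1) (n + 1)) = 0 := by
      split_ifs
      · rfl
      · exact hahnCoeff_of_lt a b N (by omega)
    have h₁ := hahnCoeff_add a b N (n + 1) 0
    have h₂ := hahnCoeff_add a b N n 0
    simp only [add_zero] at h₁ h₂
    rw [hc, hp, if_neg (Nat.succ_ne_zero n), Nat.add_sub_cancel, h₁, h₂,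
      show n + 1 + (n + 1) = n + n + 1 + 1 by ring]
    simp only [pch_succ, pch_zero, Nat.factorial_succ, Nat.factorial_zero]
    push_cast
    have := hD n
    have := hQ n
    have := hf n
    have := hsucc n
    have := ha n
    have := habN n
    field_simp
    rw [hs]
    ring
  obtain rfl | hlt' := eq_or_lt_of_le (Nat.lt_succ_iff.mp hlt)
  · have hp : (if j = 0 then 0 else hahnCoeff a b N (j - 1) j) = 0 := by
      split_ifs
      · rfl
      · exact hahnCoeff_of_lt a b N (by omega)
    rw [hp]
    cases j with
    | zero =>
      have h₁ := hahnCoeff_add a b N 0 1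
      have h₂ := hahnCoeff_add a b N 0 0
      simp only [Nat.cast_zero, mul_zero, zero_add] at hs
      simp [pch_succ, pch_zero] at h₁ h₂ ⊢
      rw [h₁, h₂]
      have := habN 0
      simp only [Nat.cast_zero, add_zero] at this
      field_simp
      rw [hs]
      ring
    | succ i =>
      have h₁ := hahnCoeff_add a b N (i + 1) 1
      have h₂ := hahnCoeff_add a b N (i + 1) 0
      have h₃ := hahnCoeff_add a b N i 1
      simp only [add_zero] at h₂
      rw [if_neg (Nat.succ_ne_zero i), Nat.add_sub_cancel, h₁, h₂, h₃,
        show i + 1 + (i + 1 + 1) = i + (i + 1) + 1 + 1 by ring,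
        show i + 1 + (i + 1) = i + (i + 1) + 1 by ring]
      have hab := habN (i + 1)
      have := hD (i + 1)
      have := hQ i
      have := hf i
      have := hsucc i
      have := ha i
      rw [pch_succ (i + 1) (2 + a + b + N), pch_succ (i + (i + 1) + 1), pch_succ (i + (i + 1))]
      simp only [pch_succ i (a + 1), pch_succ 0, pch_zero, Nat.factorial_succ, Nat.factorial_zero]
      push_cast at this hab hs ⊢
      field_simp
      rw [hs]
      ring
  obtain ⟨m, rfl⟩ := Nat.exists_eq_add_of_lt hlt'
  have h₁ := hahnCoeff_add a b N j (m + 2)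
  have h₂ := hahnCoeff_add a b N j (m + 1)
  have h₃ := hahnCoeff_add a b N j m
  have hR₁ : pch (m + 1) (N - ((j : ℝ) + (m + 1 : ℕ)) + 1) =
      (N - j - m) * pch m (N - ((j : ℝ) + m) + 1) := by
    rw [pch_succ_left]
    push_cast
    ring_nf
  have hR₂ : pch (m + 2) (N - ((j : ℝ) + (m + 2 : ℕ)) + 1) =
      (N - j - m - 1) * (N - j - m) * pch m (N - ((j : ℝ) + m) + 1) := by
    rw [pch_succ_left, pch_succ_left]
    push_cast
    ring_nf
  rw [hR₂] at h₁
  rw [hR₁] at h₂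
  rw [if_neg (Nat.succ_ne_zero (j + m)), Nat.add_sub_cancel]
  rw [show j + m + 1 + 1 = j + (m + 2) by ring, show j + m + 1 = j + (m + 1) by ring, h₁, h₂, h₃,
    show j + (m + 2) = j + m + 1 + 1 by ring, show j + (m + 1) = j + m + 1 by ring,
    show j + (j + m + 1 + 1) = j + (j + m) + 1 + 1 by ring,
    show j + (j + m + 1) = j + (j + m) + 1 by ring]
  have hd₀ := hD (j + m)
  have hd₁ := habN (j + m)
  have hd₂ := habN (j + m + 1)
  have := hf m
  have := hsucc m
  have := hsucc2 m
  cases j with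
  | zero =>
    simp only [Nat.cast_zero, zero_add] at hd₀ hd₁ hd₂ hs ⊢
    simp only [zero_mul, if_true, Nat.factorial_succ, pch_zero, pch_succ, Nat.factorial_zero]
    push_cast at hd₁ hd₂ hs ⊢
    field_simp
    rw [hs]
    ring
  | succ i =>
    have h₄ := hahnCoeff_add a b N i (m + 2)
    have hR₃ : pch (m + 2) (N - ((i : ℝ) + (m + 2 : ℕ)) + 1) =
        (N - (i + 1) - m) * pch m (N - (((i + 1 : ℕ) : ℝ) + m) + 1) * (N - i) := by
      rw [pch_succ_left, pch_succ]
      push_cast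
      ring_nf
    rw [hR₃, show i + (m + 2) = i + 1 + m + 1 by ring,
      show i + (i + 1 + m + 1) = i + 1 + (i + 1 + m) by ring] at h₄
    rw [if_neg (Nat.succ_ne_zero i), Nat.add_sub_cancel, h₄]
    have := hQ i
    have := hf i
    have := hsucc i
    have := ha i
    simp only [pch_succ (i + 1 + m + 1) (2 + a + b + N), pch_succ (i + 1 + m) (2 + a + b + N),
      pch_succ (i + 1 + (i + 1 + m) + 1), pch_succ (i + 1 + (i + 1 + m)) (a + b + 1),
      pch_succ i (a + 1), Nat.factorial_succ]
    push_cast at hd₁ hd₂ hs ⊢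
    field_simp
    rw [hs]
    ring

/-- Three-term recurrence relation for the Hahn polynomials. -/
theorem hahn_three_term_recurrence (a b N : ℝ)
    (ha : ∀ k : ℕ, a ≠ -((k : ℝ) + 1))
    (hab1 : ∀ k : ℕ, a + b + 1 ≠ -((k : ℝ) + 1))
    (habN1 : ∀ k : ℕ, a + b + N + 1 ≠ -((k : ℝ) + 1))
    (n : ℕ)
    (h1 : 2 * (n : ℝ) + a + b - 1 ≠ 0)
    (h2 : 2 * (n : ℝ) + a + b ≠ 0)
    (h3 : 2 * (n : ℝ) + a + b + 1 ≠ 0)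
    (h4 : 2 * (n : ℝ) + a + b + 2 ≠ 0) :
    Polynomial.X * hahn a b N n
      = Polynomial.C (-((((n : ℝ) + 1) * (((n : ℝ) + 1) + a) * (((n : ℝ) + 1) + a + b + N + 1)) /
            ((2 * ((n : ℝ) + 1) + a + b - 1) * (2 * ((n : ℝ) + 1) + a + b)))) *
          hahn a b N (n + 1)
        + Polynomial.C ((N * (a + 1) * (a + b) + (n : ℝ) * (2 * N + b - a) * ((n : ℝ) + a + b + 1)) /
            ((2 * (n : ℝ) + a + b) * (2 * (n : ℝ) + a + b + 2))) *
          hahn a b N n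
        + Polynomial.C (-((((n : ℝ) + a + b) * ((n : ℝ) + b) * (N - (n : ℝ) + 1)) /
            ((2 * (n : ℝ) + a + b) * (2 * (n : ℝ) + a + b + 1)))) *
          (if n = 0 then 0 else hahn a b N (n - 1)) := by
  have ha' : ∀ k : ℕ, a + 1 + k ≠ 0 := fun k h => ha k (by linarith)
  have habN' : ∀ k : ℕ, 2 + a + b + N + k ≠ 0 := fun k h => habN1 k (by linarith)
  have hprev : (if n = 0 then 0 else hahn a b N (n - 1)) = ∑ j ∈ Finset.range (n + 2),
      C (if n = 0 then 0 else hahnCoeff a b N (n - 1) j) *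
        (ascPochhammer ℝ j).comp (-X) := by
    split_ifs
    · simp
    · exact hahn_eq_sum a b N (by omega)
  rw [X_mul_hahn, hprev, hahn_eq_sum a b N (Nat.lt_succ_self (n + 1)),
    hahn_eq_sum a b N (show n < n + 2 by omega), Finset.mul_sum, Finset.mul_sum, Finset.mul_sum,
    ← Finset.sum_add_distrib, ← Finset.sum_add_distrib]
  refine Finset.sum_congr rfl fun j hj => ?_
  rw [hahnCoeff_recurrence a b N ha' habN' n j (Nat.lt_succ_iff.mp (Finset.mem_range.mp hj))
    rfl h2 h3 h4,
    show 2 * ((n : ℝ) + 1) + a + b - 1 = 2 * (n : ℝ) + a + b + 1 by ring,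
    show 2 * ((n : ℝ) + 1) + a + b = 2 * (n : ℝ) + a + b + 2 by ring]
  simp only [C_add, C_mul, add_mul, mul_assoc]
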